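/- For every finitely supported nonzero k : ℤ → ℤ and every δ > 0, the set {v ∈ [0,1]^ℤ : |∑_{j∈ℤ} k_j v_j| < δ} is measurable and μ({v ∈ [0,1]^ℤ : |∑_{j∈ℤ} k_j v_j| < δ}) ≤ 2δ. -/

import Mathlib

/-- `μ` is the product over `j ∈ ℤ` of the uniform probability measure on `[0,1]`:
a probability measure on `ℤ → ℝ` (with the product σ-algebra) whose finite-dimensional
cylinder marginals are products of the uniform measure on `[0,1]`. -/
def IsUnifProd (μ : MeasureTheory.Measure (ℤ → ℝ)) : Prop :=
  MeasureTheory.IsProbabilityMeasure μ ∧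
    ∀ (s : Finset ℤ) (B : ℤ → Set ℝ), (∀ j, MeasurableSet (B j)) →
      μ {v | ∀ j ∈ s, v j ∈ B j} = ∏ j ∈ s, MeasureTheory.volume (B j ∩ Set.Icc 0 1)

open MeasureTheory ProbabilityTheory

namespace IsUnifProd

variable {μ : Measure (ℤ → ℝ)}

/-- Each coordinate is uniformly distributed on `[0,1]`. -/
lemma measure_eval_mem (hμ : IsUnifProd μ) (i : ℤ) {B : Set ℝ} (hB : MeasurableSet B) :
    μ {v | v i ∈ B} = volume (B ∩ Set.Icc 0 1) := by
  simpa using hμ.2 {i} (fun _ => B) fun _ => hB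

/-- The coordinates are mutually independent. -/
lemma iIndepFun_eval (hμ : IsUnifProd μ) : iIndepFun (fun (j : ℤ) (v : ℤ → ℝ) => v j) μ := by
  classical
  rw [iIndepFun_iff_measure_inter_preimage_eq_mul]
  intro s B hB
  have hB' : ∀ j, MeasurableSet (if j ∈ s then B j else ∅) := fun j => by
    split_ifs with h
    exacts [hB j h, MeasurableSet.empty]
  have key := hμ.2 s (fun j => if j ∈ s then B j else ∅) hB'
  have hset : (⋂ i ∈ s, (fun v : ℤ → ℝ => v i) ⁻¹' B i) =
      {v | ∀ j ∈ s, v j ∈ if j ∈ s then B j else ∅} := by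
    ext v
    simp +contextual
  rw [hset, key]
  refine Finset.prod_congr rfl fun j hj => ?_
  rw [if_pos hj]
  exact (hμ.measure_eval_mem j (hB j hj)).symm

end IsUnifProd

/-- If the probability that `Y` lies in an interval of radius `δ` is at most `C` whatever the
center of the interval, then the same holds for `X + Y` when `X` is independent of `Y`. -/
lemma ProbabilityTheory.IndepFun.measure_abs_add_lt_le {Ω : Type*} [MeasurableSpace Ω]
    {μ : Measure Ω} [IsProbabilityMeasure μ] {X Y : Ω → ℝ} (h : IndepFun X Y μ)
    (hX : Measurable X) (hY : Measurable Y) {δ : ℝ} {C : ENNReal}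
    (hC : ∀ x, μ {ω | |x + Y ω| < δ} ≤ C) : μ {ω | |X ω + Y ω| < δ} ≤ C := by
  have hA : MeasurableSet {p : ℝ × ℝ | |p.1 + p.2| < δ} :=
    measurableSet_lt (by fun_prop) measurable_const
  have : IsProbabilityMeasure (μ.map X) := Measure.isProbabilityMeasure_map hX.aemeasurable
  calc μ {ω | |X ω + Y ω| < δ}
      = μ.map (fun ω => (X ω, Y ω)) {p : ℝ × ℝ | |p.1 + p.2| < δ} :=
        (Measure.map_apply (hX.prodMk hY) hA).symm
    _ = ∫⁻ x, μ.map Y (Prod.mk x ⁻¹' {p : ℝ × ℝ | |p.1 + p.2| < δ}) ∂(μ.map X) := by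
        rw [(indepFun_iff_map_prod_eq_prod_map_map hX.aemeasurable hY.aemeasurable).1 h,
          Measure.prod_apply hA]
    _ ≤ ∫⁻ _, C ∂(μ.map X) := lintegral_mono fun x => by
        rw [Measure.map_apply hY (measurable_prodMk_left hA)]
        exact hC x
    _ = C := by simp

/-- Affine maps of slope at least one in absolute value do not increase the size of preimages of
intervals. -/
lemma volume_abs_add_mul_lt_le {c : ℝ} (hc : 1 ≤ |c|) (x δ : ℝ) :
    volume {t : ℝ | |x + c * t| < δ} ≤ ENNReal.ofReal (2 * δ) := by
  have hc0 : c ≠ 0 := abs_pos.1 (zero_lt_one.trans_le hc)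
  rw [← Real.volume_ball (-x / c)]
  refine measure_mono fun t (ht : |x + c * t| < δ) => ?_
  rw [Metric.mem_ball, Real.dist_eq]
  have hxt : x + c * t = c * (t - -x / c) := by
    field_simp
    ring
  rw [hxt, abs_mul] at ht
  exact (le_mul_of_one_le_left (abs_nonneg _) hc).trans_lt ht

/-- For every finitely supported nonzero `k : ℤ → ℤ` and every `δ > 0`, the set
`{v ∈ [0,1]^ℤ : |∑ j, k_j v_j| < δ}` is measurable and has measure at most `2δ`. -/
theorem statement_14 (μ : MeasureTheory.Measure (ℤ → ℝ)) (hμ : IsUnifProd μ)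
    (k : ℤ →₀ ℤ) (hk : k ≠ 0) (δ : ℝ) (hδ : 0 < δ) :
    MeasurableSet {v : ℤ → ℝ |
        (∀ j, v j ∈ Set.Icc (0 : ℝ) 1) ∧ |∑ j ∈ k.support, (k j : ℝ) * v j| < δ} ∧
      μ {v : ℤ → ℝ |
          (∀ j, v j ∈ Set.Icc (0 : ℝ) 1) ∧ |∑ j ∈ k.support, (k j : ℝ) * v j| < δ} ≤
        ENNReal.ofReal (2 * δ) := by
  have := hμ.1
  constructor
  · have hcube : MeasurableSet {v : ℤ → ℝ | ∀ j, v j ∈ Set.Icc (0 : ℝ) 1} := by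
      rw [Set.ofPred_forall]
      exact MeasurableSet.iInter fun j => measurable_pi_apply j measurableSet_Icc
    have hsum : MeasurableSet {v : ℤ → ℝ | |∑ j ∈ k.support, (k j : ℝ) * v j| < δ} :=
      measurableSet_lt (by fun_prop) measurable_const
    exact hcube.inter hsum
  obtain ⟨i, hi⟩ := Finsupp.support_nonempty_iff.2 hk
  have hc : 1 ≤ |(k i : ℝ)| := by
    exact_mod_cast Int.one_le_abs (Finsupp.mem_support_iff.1 hi)
  have hscaled : iIndepFun (fun (j : ℤ) (v : ℤ → ℝ) => (k j : ℝ) * v j) μ :=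
    hμ.iIndepFun_eval.comp (fun j t => (k j : ℝ) * t) fun j => by fun_prop
  have hindep := hscaled.indepFun_finsetSum_of_notMem (fun j => by fun_prop)
    (Finset.notMem_erase i k.support)
  refine le_trans (measure_mono fun v hv => ?_)
    (hindep.measure_abs_add_lt_le (δ := δ) (by fun_prop) (by fun_prop) fun x => ?_)
  · have := hv.2
    rw [← Finset.sum_erase_add _ _ hi] at this
    simpa using this
  · exact (hμ.measure_eval_mem i (B := {t | |x + k i * t| < δ})
      (measurableSet_lt (by fun_prop) measurable_const)).trans_le
        ((measure_mono Set.inter_subset_left).trans (volume_abs_add_mul_lt_le hc x δ))
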